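/- Let K be an infinite field. Then the class of K-representable matroids is not pigeonhole: there is a positive integer λ such that for every integer ρ there exists a K-representable matroid M with branch-width at most λ and decomposition-width greater than ρ. In fact, there are rank-3 K-representable matroids of arbitrarily high decomposition-width. -/

import Mathlib

open Set

noncomputable def mrank {α : Type*} (M : Matroid α) (X : Set α) : ℕ :=
  sSup {n | ∃ I, I ⊆ X ∧ M.Indep I ∧ I.ncard = n}

noncomputable def connVal {α : Type*} (M : Matroid α) (U : Set α) : ℕ :=
  mrank M U + mrank M (M.E \ U) - mrank M M.E

def Sim {α : Type*} (M : Matroid α) (U X X' : Set α) : Prop :=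
  ∀ Z ⊆ M.E \ U, (M.Indep (X ∪ Z) ↔ M.Indep (X' ∪ Z))

def SimClassesLE {α : Type*} (M : Matroid α) (U : Set α) (k : ℕ) : Prop :=
  ∃ f : Set α → Fin k, ∀ X X' : Set α, X ⊆ U → X' ⊆ U → f X = f X' → Sim M U X X'

structure Decomp {α : Type*} (M : Matroid α) where
  V : Type
  fin : Finite V
  T : SimpleGraph V
  conn : T.Connected
  acyc : T.IsAcyclic
  deg : ∀ v : V, (T.neighborSet v).ncard = 1 ∨ (T.neighborSet v).ncard = 3
  leafEquiv : M.E ≃ {v : V // (T.neighborSet v).ncard = 1}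

def Decomp.Displays {α : Type*} {M : Matroid α} (D : Decomp M) (U : Set α) : Prop :=
  ∃ u v : D.V, D.T.Adj u v ∧
    U = {x | ∃ h : x ∈ M.E, (D.T.deleteEdges {s(u, v)}).Reachable (D.leafEquiv ⟨x, h⟩).1 u}

def bwLE {α : Type*} (M : Matroid α) (k : ℕ) : Prop :=
  ∃ D : Decomp M, ∀ U, D.Displays U → connVal M U + 1 ≤ k

def dwLE {α : Type*} (M : Matroid α) (k : ℕ) : Prop :=
  ∃ D : Decomp M, ∀ U, D.Displays U → SimClassesLE M U k

def Pigeonhole {α : Type*} (C : Set (Matroid α)) : Prop :=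
  ∀ l : ℕ, 0 < l → ∃ ρ : ℕ, ∀ M ∈ C, bwLE M l → dwLE M ρ

/-- `M` is representable over the field `K`. -/
def KRepresentable {α : Type*} (K : Type) [Field K] (M : Matroid α) : Prop :=
  ∃ (W : Type) (_ : AddCommGroup W) (_ : Module K W) (v : α → W),
    ∀ X ⊆ M.E, (M.Indep X ↔ Set.InjOn v X ∧ LinearIndependent K (fun x : X => v x.1))

/-- The linear matroid on a finite ground set `E` represented by the vectors `v`. -/
def linearMatroid {α W : Type*} (K : Type*) [Field K] [AddCommGroup W] [Module K W]
    (v : α → W) {E : Set α} (hE : E.Finite) : Matroid α :=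
  (IndepMatroid.ofFinite hE (fun I ↦ I ⊆ E ∧ LinearIndepOn K v I)
    ⟨empty_subset _, linearIndepOn_empty K v⟩
    (fun _ _ hJ hIJ ↦ ⟨hIJ.trans hJ.1, hJ.2.mono hIJ⟩)
    (by
      rintro I J ⟨hIE, hI⟩ ⟨hJE, hJ⟩ hlt
      by_contra! hcon
      have hspan : ∀ e ∈ J, v e ∈ Submodule.span K (v '' I) := by
        intro e he
        by_cases heI : e ∈ I
        · exact Submodule.subset_span (mem_image_of_mem v heI)
        · by_contra hes
          exact hcon e he heI (insert_subset (hJE he) hIE) (hI.insert hes)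
      have hle : Submodule.span K (v '' J) ≤ Submodule.span K (v '' I) :=
        Submodule.span_le.2 (by rintro _ ⟨e, he, rfl⟩; exact hspan e he)
      have hIf := hE.subset hIE
      have hfin : ∀ {X : Set α}, X.Finite → LinearIndepOn K v X →
          Module.finrank K (Submodule.span K (v '' X)) = X.ncard := by
        intro X hXf hX
        have := hXf.fintype
        have h := finrank_span_eq_card (R := K) (b := fun x : X ↦ v x) hX
        rw [← Nat.card_eq_fintype_card, Nat.card_coe_set_eq] at h
        rw [← h, image_eq_range]
      have := FiniteDimensional.span_of_finite K (hIf.image v)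
      have h := Submodule.finrank_mono hle
      rw [hfin hIf hI, hfin (hE.subset hJE) hJ] at h
      omega)
    (fun _ hI ↦ hI.1)).matroid

theorem linearMatroid_indep {α W K : Type*} [Field K] [AddCommGroup W] [Module K W]
    (v : α → W) {E : Set α} (hE : E.Finite) (I : Set α) :
    (linearMatroid K v hE).Indep I ↔ I ⊆ E ∧ LinearIndepOn K v I := Iff.rfl

theorem kRepresentable_linearMatroid {α : Type*} {W K : Type} [Field K] [AddCommGroup W]
    [Module K W] (v : α → W) {E : Set α} (hE : E.Finite) :
    KRepresentable K (linearMatroid K v hE) := by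
  refine ⟨W, inferInstance, inferInstance, v, fun X hX ↦ ?_⟩
  rw [linearMatroid_indep]
  exact ⟨fun h ↦ ⟨h.2.injOn, h.2⟩, fun h ↦ ⟨hX, h.2⟩⟩

namespace SimpleGraph

variable {V : Type*} {T : SimpleGraph V}

/-- The vertices on the `u` side of the edge `uv`. -/
def side (T : SimpleGraph V) (u v : V) : Set V :=
  {x | (T.deleteEdges {s(u, v)}).Reachable x u}

theorem side_union_side (hT : T.Connected) (u v x : V) : x ∈ T.side u v ∨ x ∈ T.side v u := by
  classical
  obtain ⟨p, hp⟩ := (hT.preconnected x u).exists_isPath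
  by_cases he : s(u, v) ∈ p.edges
  · right
    have hv : v ∈ p.support := p.snd_mem_support_of_mem_edges he
    have huv : u ≠ v := (p.adj_of_mem_edges he).ne
    have hu : u ∉ (p.takeUntil v hv).support :=
      SimpleGraph.Walk.endpoint_notMem_support_takeUntil hp hv huv
    refine ⟨(p.takeUntil v hv).toDeleteEdges _ fun e h₁ h₂ ↦ hu ?_⟩
    rw [mem_singleton_iff] at h₂
    subst h₂
    exact Walk.snd_mem_support_of_mem_edges _ h₁
  · left
    exact ⟨p.toDeleteEdges _ fun e h₁ h₂ ↦ he (by rwa [mem_singleton_iff.1 h₂] at h₁)⟩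

theorem IsAcyclic.disjoint_side (hT : T.IsAcyclic) {u v : V} (huv : T.Adj u v) :
    Disjoint (T.side u v) (T.side v u) := by
  rw [Set.disjoint_left]
  intro x hu hv
  have hb := isAcyclic_iff_forall_adj_isBridge.1 hT huv
  rw [isBridge_iff] at hb
  refine hb ((Reachable.symm hu).trans ?_)
  have hv' : (T.deleteEdges {s(v, u)}).Reachable x v := hv
  rwa [Sym2.eq_swap] at hv'

theorem mem_side_self (u v : V) : u ∈ T.side u v := Reachable.refl u

theorem IsAcyclic.side_ssubset_side (hT : T.IsAcyclic) {u v w : V} (huw : T.Adj u w)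
    (hne : w ≠ v) : T.side w u ⊂ T.side u v := by
  classical
  have hu : u ∉ T.side w u :=
    fun h ↦ Set.disjoint_left.1 (hT.disjoint_side huw) (mem_side_self u w) h
  refine (Set.ssubset_iff_of_subset ?_).2 ⟨u, mem_side_self u v, hu⟩
  rintro x ⟨p⟩
  have hup : u ∉ p.support := fun h ↦ hu ⟨p.dropUntil u h⟩
  have hxw : (T.deleteEdges {s(u, v)}).Reachable x w := by
    refine ⟨(p.mapLe (deleteEdges_le _)).toDeleteEdges _ fun e h₁ h₂ ↦ hup ?_⟩
    rw [mem_singleton_iff] at h₂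
    subst h₂
    simpa using Walk.fst_mem_support_of_mem_edges _ h₁
  refine hxw.trans (Adj.reachable ?_)
  rw [deleteEdges_adj]
  refine ⟨huw.symm, ?_⟩
  have := huw.ne
  simp only [mem_singleton_iff, Sym2.eq_iff]
  grind

theorem exists_mem_side_of_ne {u v x : V} (hx : x ∈ T.side u v) (hxu : x ≠ u) :
    ∃ w, T.Adj u w ∧ w ≠ v ∧ x ∈ T.side w u := by
  classical
  obtain ⟨p, hp⟩ := (Reachable.symm hx).exists_isPath
  cases p with
  | nil => exact absurd rfl hxu
  | @cons _ w _ h q =>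
    rw [Walk.cons_isPath_iff] at hp
    rw [deleteEdges_adj] at h
    refine ⟨w, h.1, ?_, Reachable.symm ⟨(q.mapLe (deleteEdges_le _)).toDeleteEdges _
      fun e h₁ h₂ ↦ hp.2 ?_⟩⟩
    · rintro rfl
      exact h.2 rfl
    · rw [mem_singleton_iff] at h₂
      subst h₂
      simpa using Walk.snd_mem_support_of_mem_edges _ h₁

/-- In a subcubic tree, some edge splits any large family of leaves in a balanced way. -/
theorem exists_balanced_edge [Finite V] (hc : T.Connected) (ha : T.IsAcyclic)
    (hdeg : ∀ v : V, (T.neighborSet v).ncard = 1 ∨ (T.neighborSet v).ncard = 3)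
    {ι : Type*} [Finite ι] (s : ι → V) (hs : s.Injective)
    (hleaf : ∀ i, (T.neighborSet (s i)).ncard = 1) {m : ℕ} (hm : 2 ≤ m)
    (hcard : 3 * m ≤ Nat.card ι) :
    ∃ u v, T.Adj u v ∧ m ≤ {i | s i ∈ T.side u v}.ncard ∧ m ≤ {i | s i ∈ T.side v u}.ncard := by
  have hsum : ∀ u v, 3 * m ≤ {i | s i ∈ T.side u v}.ncard + {i | s i ∈ T.side v u}.ncard := by
    intro u v
    refine hcard.trans (le_trans ?_ (ncard_union_le _ _))
    rw [← ncard_univ]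
    exact ncard_le_ncard fun i _ ↦ side_union_side hc u v (s i)
  let P : Set (V × V) := {e | T.Adj e.1 e.2 ∧ m ≤ {i | s i ∈ T.side e.1 e.2}.ncard}
  have hP : P.Nonempty := by
    have : Nonempty ι := (Nat.card_pos_iff.1 (by omega)).1
    let u := s (Classical.arbitrary ι)
    obtain ⟨v, huv⟩ : (T.neighborSet u).Nonempty :=
      nonempty_of_ncard_ne_zero (by rw [hleaf]; exact one_ne_zero)
    have h := hsum u v
    by_cases h' : m ≤ {i | s i ∈ T.side u v}.ncard
    · exact ⟨(u, v), huv, h'⟩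
    · exact ⟨(v, u), SimpleGraph.Adj.symm huv, by dsimp only; omega⟩
  obtain ⟨⟨u, v⟩, ⟨huv, hw⟩, hmin⟩ :=
    exists_min_image P (fun e ↦ (T.side e.1 e.2).ncard) (toFinite P) hP
  dsimp only at huv hw hmin
  have hlt : ∀ w, T.Adj u w → w ≠ v → {i | s i ∈ T.side w u}.ncard < m := by
    intro w huw hwv
    by_contra! h
    have h₁ := hmin (w, u) ⟨huw.symm, h⟩
    have h₂ := ncard_lt_ncard (ha.side_ssubset_side huw hwv)
    dsimp only at h₁
    omega
  have hvu : v ∈ T.neighborSet u := huv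
  rcases hdeg u with h1 | h3
  · obtain ⟨z, hz⟩ := ncard_eq_one.1 h1
    have hle : {i | s i ∈ T.side u v}.ncard ≤ 1 := by
      rw [ncard_le_one]
      have key : ∀ i, s i ∈ T.side u v → s i = u := by
        intro i hi
        by_contra hne
        obtain ⟨w, huw, hwv, -⟩ := exists_mem_side_of_ne hi hne
        have hwu : w ∈ T.neighborSet u := huw
        rw [hz, mem_singleton_iff] at hvu hwu
        exact hwv (hwu.trans hvu.symm)
      exact fun i hi j hj ↦ hs ((key i hi).trans (key j hj).symm)
    omega
  · have h2 : (T.neighborSet u \ {v}).ncard = 2 := by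
      rw [ncard_sdiff_singleton_of_mem hvu, h3]
    obtain ⟨w₁, w₂, -, hww⟩ := ncard_eq_two.1 h2
    have hmem : ∀ w, w ∈ T.neighborSet u \ {v} ↔ w = w₁ ∨ w = w₂ := by
      intro w
      rw [hww]
      simp
    have hw₁ := (hmem w₁).2 (.inl rfl)
    have hw₂ := (hmem w₂).2 (.inr rfl)
    have hle : {i | s i ∈ T.side u v}.ncard ≤
        {i | s i ∈ T.side w₁ u}.ncard + {i | s i ∈ T.side w₂ u}.ncard := by
      refine le_trans (ncard_le_ncard fun i hi ↦ ?_) (ncard_union_le _ _)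
      have hne : s i ≠ u := by
        intro h
        have := hleaf i
        rw [h] at this
        omega
      obtain ⟨w, huw, hwv, hiw⟩ := exists_mem_side_of_ne hi hne
      rcases (hmem w).1 ⟨huw, hwv⟩ with rfl | rfl
      · exact .inl hiw
      · exact .inr hiw
    have l₁ := hlt w₁ hw₁.1 hw₁.2
    have l₂ := hlt w₂ hw₂.1 hw₂.2
    have := hsum u v
    exact ⟨u, v, huv, hw, by omega⟩

end SimpleGraph

theorem Decomp.ground_diff_side {α : Type*} {M : Matroid α} (D : Decomp M) {u v : D.V}
    (huv : D.T.Adj u v) :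
    M.E \ {x | ∃ h : x ∈ M.E, (D.leafEquiv ⟨x, h⟩).1 ∈ D.T.side u v} =
      {x | ∃ h : x ∈ M.E, (D.leafEquiv ⟨x, h⟩).1 ∈ D.T.side v u} := by
  ext x
  constructor
  · rintro ⟨hx, hxu⟩
    exact ⟨hx, (D.T.side_union_side D.conn u v _).resolve_left fun h ↦ hxu ⟨hx, h⟩⟩
  · rintro ⟨hx, hxv⟩
    refine ⟨hx, ?_⟩
    rintro ⟨_, hxu⟩
    exact Set.disjoint_left.1 (D.acyc.disjoint_side huv) hxu hxv

theorem SimClassesLE.exists_sim {α ι : Type*} {M : Matroid α} {U : Set α} {k : ℕ}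
    (h : SimClassesLE M U k) {P : Set ι} (hP : k < P.ncard) (g : ι → Set α)
    (hg : ∀ i ∈ P, g i ⊆ U) : ∃ i ∈ P, ∃ j ∈ P, i ≠ j ∧ Sim M U (g i) (g j) := by
  obtain ⟨f, hf⟩ := h
  have hcard : (univ : Set (Fin k)).ncard < P.ncard := by
    rwa [ncard_univ, Nat.card_eq_fintype_card, Fintype.card_fin]
  obtain ⟨i, hi, j, hj, hij, he⟩ :=
    exists_ne_map_eq_of_ncard_lt_of_maps_to (f := fun i ↦ f (g i)) hcard (fun _ _ ↦ mem_univ _)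
  exact ⟨i, hi, j, hj, hij, hf _ _ (hg i hi) (hg j hj) he⟩

/-- Points `c i j` of `M` such that the lines spanned by the pairs `b j`, `c i j` meet the points
`a` in exactly `a i`. -/
structure Crosses {α ι : Type*} (M : Matroid α) (a b : ι → α) (c : ι → ι → α) : Prop where
  mem_left : ∀ i, a i ∈ M.E
  mem_right : ∀ i, b i ∈ M.E
  mem_cross : ∀ i j, c i j ∈ M.E
  dep : ∀ i j, ¬ M.Indep ({a i} ∪ {b j, c i j})
  indep : ∀ i i' j, i' ≠ i → M.Indep ({a i'} ∪ {b j, c i j})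

theorem Crosses.false_of_lt_ncard {α ι : Type*} {M : Matroid α} {a b : ι → α} {c : ι → ι → α}
    (h : Crosses M a b c) (h' : Crosses M b a fun i j ↦ c j i) {k : ℕ} {U : Set α}
    (hU : SimClassesLE M U k) (hV : SimClassesLE M (M.E \ U) k)
    (ha : k < {i | a i ∈ U}.ncard) (hb : k < {j | b j ∈ M.E \ U}.ncard) : False := by
  by_cases hc : ∀ i, a i ∈ U → ∃ j, b j ∈ M.E \ U ∧ c i j ∈ M.E \ U
  · obtain ⟨i, hi, i', -, hne, hsim⟩ :=
      hU.exists_sim ha (fun i ↦ {a i}) fun i hi ↦ singleton_subset_iff.2 hi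
    obtain ⟨j, hj, hij⟩ := hc i hi
    exact h.dep i j ((hsim {b j, c i j} (pair_subset hj hij)).2 (h.indep i i' j hne.symm))
  · push Not at hc
    obtain ⟨i, hi, hc⟩ := hc
    obtain ⟨j, hj, j', -, hne, hsim⟩ :=
      hV.exists_sim hb (fun j ↦ {b j}) fun j hj ↦ singleton_subset_iff.2 hj
    have hij : c i j ∈ U := by
      by_contra hn
      exact hc j hj ⟨h.mem_cross i j, hn⟩
    have hZ : {a i, c i j} ⊆ M.E \ (M.E \ U) :=
      pair_subset ⟨h.mem_left i, fun hn ↦ hn.2 hi⟩ ⟨h.mem_cross i j, fun hn ↦ hn.2 hij⟩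
    exact h'.dep j i ((hsim _ hZ).2 (h'.indep j j' i hne.symm))

theorem Crosses.not_dwLE {α ι : Type*} [Finite ι] {M : Matroid α} {a b : ι → α} {c : ι → ι → α}
    (h : Crosses M a b c) (h' : Crosses M b a fun i j ↦ c j i)
    (hinj : (Sum.elim a b).Injective) {k : ℕ} (hι : 3 * (k + 1) ≤ Nat.card ι) :
    ¬ dwLE M k := by
  rintro ⟨D, hD⟩
  have := D.fin
  have hmem : ∀ x : ι ⊕ ι, Sum.elim a b x ∈ M.E := by
    rintro (i | i)
    exacts [h.mem_left i, h.mem_right i]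
  let s : ι ⊕ ι → D.V := fun x ↦ (D.leafEquiv ⟨Sum.elim a b x, hmem x⟩).1
  have hs : s.Injective := by
    intro x y hxy
    have := D.leafEquiv.injective (Subtype.ext hxy)
    exact hinj (congrArg Subtype.val this)
  obtain ⟨u, v, huv, hu, hv⟩ := SimpleGraph.exists_balanced_edge D.conn D.acyc D.deg s hs
    (fun x ↦ (D.leafEquiv ⟨Sum.elim a b x, hmem x⟩).2) (m := 2 * (k + 1)) (by omega)
    (by rw [Nat.card_sum]; omega)
  set U := {x | ∃ h : x ∈ M.E, (D.leafEquiv ⟨x, h⟩).1 ∈ D.T.side u v} with hUdef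
  have hVdef := Decomp.ground_diff_side D huv
  rw [← hUdef] at hVdef
  have hU : SimClassesLE M U k := hD U ⟨u, v, huv, rfl⟩
  have hV : SimClassesLE M (M.E \ U) k := hD _ ⟨v, u, huv.symm, hVdef⟩
  have hcount : ∀ X : Set α, ∀ p q : D.V,
      X = {x | ∃ h : x ∈ M.E, (D.leafEquiv ⟨x, h⟩).1 ∈ D.T.side p q} →
      {x | s x ∈ D.T.side p q}.ncard ≤ {i | a i ∈ X}.ncard + {j | b j ∈ X}.ncard := by
    rintro X p q rfl
    rw [← ncard_image_of_injective _ (Sum.inl_injective (α := ι) (β := ι)),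
      ← ncard_image_of_injective {j | b j ∈ _} (Sum.inr_injective (α := ι) (β := ι))]
    refine le_trans (ncard_le_ncard ?_) (ncard_union_le _ _)
    rintro (i | i) hi
    · exact .inl ⟨i, ⟨h.mem_left i, hi⟩, rfl⟩
    · exact .inr ⟨i, ⟨h.mem_right i, hi⟩, rfl⟩
  have cu := hcount U u v rfl
  have cv := hcount (M.E \ U) v u hVdef
  have hsplit : ∀ f : ι → α, (∀ i, f i ∈ M.E) →
      Nat.card ι ≤ {i | f i ∈ U}.ncard + {i | f i ∈ M.E \ U}.ncard := by
    intro f hf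
    rw [← ncard_univ]
    refine le_trans (ncard_le_ncard fun i _ ↦ ?_) (ncard_union_le _ _)
    by_cases hi : f i ∈ U
    exacts [.inl hi, .inr ⟨hf i, hi⟩]
  have sa := hsplit a h.mem_left
  have sb := hsplit b h.mem_right
  by_cases hab : k < {i | a i ∈ U}.ncard ∧ k < {j | b j ∈ M.E \ U}.ncard
  · exact h.false_of_lt_ncard h' hU hV hab.1 hab.2
  · exact h'.false_of_lt_ncard h hU hV (by omega) (by omega)

/-- The cubic caterpillar with `m + 2` leaves: the parent of a vertex `k > 0` is the largest odd
number below `k`, or `0` if `k = 1`. -/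
def caterpillar (m : ℕ) : SimpleGraph (Fin (2 * m + 2)) where
  Adj i j := (0 < i.1 ∧ j.1 = 2 * (i.1 / 2) - 1) ∨ (0 < j.1 ∧ i.1 = 2 * (j.1 / 2) - 1)
  symm := ⟨fun _ _ h ↦ h.symm⟩
  loopless := ⟨fun i h ↦ by omega⟩

theorem caterpillar_adj {m : ℕ} {i j : Fin (2 * m + 2)} : (caterpillar m).Adj i j ↔
    (0 < i.1 ∧ j.1 = 2 * (i.1 / 2) - 1) ∨ (0 < j.1 ∧ i.1 = 2 * (j.1 / 2) - 1) := Iff.rfl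

theorem caterpillar_connected (m : ℕ) : (caterpillar m).Connected := by
  have key : ∀ k (hk : k < 2 * m + 2), (caterpillar m).Reachable ⟨k, hk⟩ 0 := by
    intro k
    induction k using Nat.strong_induction_on with
    | _ k ih =>
      intro hk
      rcases Nat.eq_zero_or_pos k with rfl | hpos
      · exact SimpleGraph.Reachable.refl _
      · refine SimpleGraph.Reachable.trans (SimpleGraph.Adj.reachable ?_)
          (ih (2 * (k / 2) - 1) (by omega) (by omega))
        exact .inl ⟨hpos, rfl⟩
  exact ⟨fun i j ↦ (key i.1 i.2).trans (key j.1 j.2).symm⟩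

theorem caterpillar_isAcyclic (m : ℕ) : (caterpillar m).IsAcyclic := by
  intro v p hp
  obtain ⟨x, hx, hmax⟩ := exists_max_image {x | x ∈ p.support} id (toFinite _)
    ⟨v, p.start_mem_support⟩
  have hq := hp.rotate hx
  have hle : ∀ y ∈ (p.rotate x hx).support, y.1 ≤ x.1 := by
    intro y hy
    exact hmax y ((p.mem_support_rotate_iff x hx).1 hy)
  have h₁ := (p.rotate x hx).adj_snd hq.not_nil
  have h₂ := (p.rotate x hx).adj_penultimate hq.not_nil
  have l₁ := hle _ ((p.rotate x hx).getVert_mem_support 1)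
  have l₂ := hle _ ((p.rotate x hx).getVert_mem_support ((p.rotate x hx).length - 1))
  refine hq.snd_ne_penultimate (Fin.ext ?_)
  rw [caterpillar_adj] at h₁ h₂
  simp only [SimpleGraph.Walk.snd, SimpleGraph.Walk.penultimate] at *
  omega

theorem caterpillar_ncard_leaf {m : ℕ} {i : Fin (2 * m + 2)} (hi : i.1 % 2 = 0 ∨ i.1 = 2 * m + 1) :
    ((caterpillar m).neighborSet i).ncard = 1 := by
  rw [ncard_eq_one]
  rcases Nat.eq_zero_or_pos i.1 with h0 | hpos
  · refine ⟨⟨1, by omega⟩, ?_⟩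
    ext j
    simp only [SimpleGraph.mem_neighborSet, caterpillar_adj, mem_singleton_iff, Fin.ext_iff]
    omega
  · refine ⟨⟨2 * (i.1 / 2) - 1, by omega⟩, ?_⟩
    ext j
    simp only [SimpleGraph.mem_neighborSet, caterpillar_adj, mem_singleton_iff, Fin.ext_iff]
    omega

theorem caterpillar_ncard_inner {m : ℕ} {i : Fin (2 * m + 2)} (h1 : i.1 % 2 = 1)
    (h2 : i.1 ≠ 2 * m + 1) : ((caterpillar m).neighborSet i).ncard = 3 := by
  rw [ncard_eq_three]
  refine ⟨⟨2 * (i.1 / 2) - 1, by omega⟩, ⟨i.1 + 1, by omega⟩, ⟨i.1 + 2, by omega⟩, ?_, ?_, ?_, ?_⟩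
  · simp only [ne_eq, Fin.ext_iff]; omega
  · simp only [ne_eq, Fin.ext_iff]; omega
  · simp only [ne_eq, Fin.ext_iff]; omega
  · ext j
    simp only [SimpleGraph.mem_neighborSet, caterpillar_adj, mem_singleton_iff, mem_insert_iff,
      Fin.ext_iff]
    omega

theorem caterpillar_leaf_iff {m : ℕ} (i : Fin (2 * m + 2)) :
    ((caterpillar m).neighborSet i).ncard = 1 ↔ i.1 % 2 = 0 ∨ i.1 = 2 * m + 1 := by
  refine ⟨fun h ↦ ?_, caterpillar_ncard_leaf⟩
  by_contra! hn
  rw [caterpillar_ncard_inner (by omega) hn.2] at h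
  omega

theorem caterpillar_card_leaves (m : ℕ) :
    Nat.card {i // ((caterpillar m).neighborSet i).ncard = 1} = m + 2 := by
  let f : Fin (m + 2) → {i // ((caterpillar m).neighborSet i).ncard = 1} := fun t ↦
    ⟨⟨min (2 * t.1) (2 * m + 1), by omega⟩, (caterpillar_leaf_iff _).2 (by dsimp only; omega)⟩
  have hf : f.Bijective := by
    constructor
    · intro s t hst
      simp only [f, Subtype.mk.injEq, Fin.mk.injEq] at hst
      apply Fin.ext
      omega
    · rintro ⟨i, hi⟩
      have hi' := (caterpillar_leaf_iff i).1 hi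
      refine ⟨⟨(i.1 + 1) / 2, by omega⟩, ?_⟩
      simp only [f, Subtype.mk.injEq, Fin.ext_iff]
      omega
  rw [← Nat.card_congr (Equiv.ofBijective f hf), Nat.card_eq_fintype_card, Fintype.card_fin]

theorem nonempty_decomp {α : Type*} {M : Matroid α} (hE : 2 ≤ M.E.ncard) :
    Nonempty (Decomp M) := by
  obtain ⟨m, hm⟩ := Nat.exists_eq_add_of_le' hE
  have : Finite M.E := finite_of_ncard_pos (by omega)
  obtain ⟨e⟩ : Nonempty (M.E ≃ {i // ((caterpillar m).neighborSet i).ncard = 1}) :=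
    Finite.card_eq.1 (by rw [Nat.card_coe_set_eq, hm, caterpillar_card_leaves])
  refine ⟨⟨_, inferInstance, caterpillar m, caterpillar_connected m, caterpillar_isAcyclic m,
    fun i ↦ ?_, e⟩⟩
  by_cases hi : i.1 % 2 = 0 ∨ i.1 = 2 * m + 1
  · exact .inl (caterpillar_ncard_leaf hi)
  · exact .inr (caterpillar_ncard_inner (by omega) (by omega))

theorem mrank_le {α : Type*} {M : Matroid α} {r : ℕ} (hr : ∀ I, M.Indep I → I.ncard ≤ r)
    (X : Set α) : mrank M X ≤ r :=
  csSup_le' (by rintro _ ⟨I, -, hI, rfl⟩; exact hr I hI)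

theorem mrank_ground_eq {α : Type*} {M : Matroid α} {r : ℕ} (hr : ∀ I, M.Indep I → I.ncard ≤ r)
    {B : Set α} (hB : M.Indep B) (hBr : B.ncard = r) : mrank M M.E = r := by
  refine le_antisymm (mrank_le hr _) (le_csSup ⟨r, ?_⟩ ⟨B, hB.subset_ground, hB, hBr⟩)
  rintro _ ⟨I, -, hI, rfl⟩
  exact hr I hI

theorem bwLE_of_mrank {α : Type*} {M : Matroid α} {r : ℕ} (hr : ∀ I, M.Indep I → I.ncard ≤ r)
    (hM : mrank M M.E = r) (hE : 2 ≤ M.E.ncard) : bwLE M (r + 1) := by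
  obtain ⟨D⟩ := nonempty_decomp hE
  refine ⟨D, fun U _ ↦ ?_⟩
  have h₁ := mrank_le hr U
  have h₂ := mrank_le hr (M.E \ U)
  rw [connVal, hM]
  omega

theorem crosses_linearMatroid {α W K ι : Type*} [Field K] [AddCommGroup W] [Module K W]
    {v : α → W} {E : Set α} (hE : E.Finite) {a b : ι → α} {c : ι → ι → α}
    (ha : ∀ i, a i ∈ E) (hb : ∀ i, b i ∈ E) (hc : ∀ i j, c i j ∈ E)
    (hab : ∀ i j, a i ≠ b j) (hac : ∀ i i' j, a i ≠ c i' j) (hbc : ∀ i i' j, b i ≠ c i' j)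
    (hv : ∀ i j, v (c i j) = v (a i) + v (b j)) {x : ι → K} (hx : x.Injective)
    (f g h : W →ₗ[K] K) (hfa : ∀ i, f (v (a i)) = 1) (hfb : ∀ i, f (v (b i)) = 0)
    (hga : ∀ i, g (v (a i)) = 0) (hgb : ∀ i, g (v (b i)) = 1)
    (hha : ∀ i, h (v (a i)) = x i) (hhb : ∀ i, h (v (b i)) = x i) :
    Crosses (linearMatroid K v hE) a b c := by
  refine ⟨ha, hb, hc, fun i j hI ↦ ?_, fun i i' j hne ↦ ?_⟩
  · have hI := hI.2
    rw [singleton_union, linearIndepOn_insert (by simp [hac, hab])] at hI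
    refine hI.2 ?_
    rw [image_pair, Submodule.mem_span_pair]
    exact ⟨-1, 1, by rw [hv]; module⟩
  · rw [linearMatroid_indep, singleton_union]
    refine ⟨insert_subset (ha _) (pair_subset (hb _) (hc _ _)),
      (linearIndepOn_insert (by simp [hac, hab])).2 ⟨?_, ?_⟩⟩
    · rw [LinearIndepOn.pair_iff _ (hbc _ _ _)]
      intro s t hst
      have h0 := congrArg f hst
      have h1 := congrArg g hst
      simp only [hv, map_add, map_smul, map_zero, hfa, hfb, hga, hgb, smul_eq_mul] at h0 h1
      grind
    · rw [image_pair, Submodule.mem_span_pair]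
      rintro ⟨s, t, hst⟩
      have h0 := congrArg f hst
      have h1 := congrArg g hst
      have h2 := congrArg h hst
      simp only [hv, map_add, map_smul, hfa, hfb, hga, hgb, hha, hhb, smul_eq_mul] at h0 h1 h2
      refine hne (hx ?_)
      grind

theorem exists_rank_three_not_dwLE {α : Type*} [Infinite α] (K : Type) [Field K] [Infinite K] (k : ℕ) :
    ∃ M : Matroid α, KRepresentable K M ∧ mrank M M.E = 3 ∧ bwLE M 4 ∧ ¬ dwLE M k := by
  let n := 3 * (k + 1)
  let x : Fin n ↪ K := (Fin.valEmbedding).trans (Infinite.natEmbedding K)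
  let ι := (Fin n ⊕ Fin n) ⊕ (Fin n × Fin n)
  obtain ⟨e⟩ : Nonempty (ι ↪ α) :=
    ⟨(Fintype.equivFin ι).toEmbedding.trans (Fin.valEmbedding.trans (Infinite.natEmbedding α))⟩
  let vec : ι → Fin 3 → K := Sum.elim (Sum.elim (fun i ↦ ![1, 0, x i]) fun j ↦ ![0, 1, x j])
    fun p ↦ ![1, 1, x p.1 + x p.2]
  let v : α → Fin 3 → K := Function.extend e vec 0
  have hv : ∀ i, v (e i) = vec i := fun i ↦ e.injective.extend_apply _ _ i
  let a : Fin n → α := fun i ↦ e (.inl (.inl i))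
  let b : Fin n → α := fun i ↦ e (.inl (.inr i))
  let c : Fin n → Fin n → α := fun i j ↦ e (.inr (i, j))
  have hva : ∀ i, v (a i) = ![1, 0, x i] := fun i ↦ hv _
  have hvb : ∀ i, v (b i) = ![0, 1, x i] := fun i ↦ hv _
  have hvc : ∀ i j, v (c i j) = ![1, 1, x i + x j] := fun i j ↦ hv _
  have hac : ∀ i i' j, a i ≠ c i' j := fun i i' j h ↦ Sum.inl_ne_inr (e.injective h)
  have hbc : ∀ i i' j, b i ≠ c i' j := fun i i' j h ↦ Sum.inl_ne_inr (e.injective h)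
  have hab : ∀ i j, a i ≠ b j := fun i j h ↦
    Sum.inl_ne_inr (Sum.inl_injective (e.injective h))
  have hE : (range e).Finite := finite_range e
  let M := linearMatroid K v hE
  have hr : ∀ I, M.Indep I → I.ncard ≤ 3 := by
    intro I hI
    have h := hI.2.encard_le_toENat_rank
    rw [rank_fun', Fintype.card_fin, map_natCast,
      ← (hE.subset hI.1).cast_ncard_eq] at h
    exact_mod_cast h
  have hsum : ∀ i j, v (c i j) = v (a i) + v (b j) := by
    intro i j
    rw [hva, hvb, hvc]
    ext t
    fin_cases t <;> simp
  have hcross : Crosses M a b c := by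
    apply crosses_linearMatroid (a := a) (b := b) (c := c) hE (fun i ↦ ⟨_, rfl⟩)
      (fun i ↦ ⟨_, rfl⟩) (fun i j ↦ ⟨_, rfl⟩)
      hab hac hbc hsum x.injective (LinearMap.proj 0) (LinearMap.proj 1) (LinearMap.proj 2) <;>
    simp [hva, hvb]
  have hcross' : Crosses M b a fun i j ↦ c j i := by
    apply crosses_linearMatroid (a := b) (b := a) (c := fun i j ↦ c j i) hE
      (fun i ↦ ⟨_, rfl⟩) (fun i ↦ ⟨_, rfl⟩) (fun i j ↦ ⟨_, rfl⟩)
      (fun i j ↦ (hab j i).symm) (fun i i' j ↦ hbc i j i') (fun i i' j ↦ hac i j i')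
      (fun i j ↦ (hsum j i).trans (add_comm _ _)) x.injective
      (LinearMap.proj 1) (LinearMap.proj 0) (LinearMap.proj 2) <;>
    simp [hva, hvb]
  have hinj : (Sum.elim a b).Injective := by
    rintro (i | i) (j | j) hij <;> exact Sum.inl_injective (e.injective hij)
  let i₀ : Fin n := ⟨0, by omega⟩
  let i₁ : Fin n := ⟨1, by omega⟩
  have hbase := hcross.indep i₀ i₁ i₀ (by simp [i₀, i₁])
  have hcard : ({a i₁} ∪ {b i₀, c i₀ i₀} : Set α).ncard = 3 := by
    rw [singleton_union, ncard_eq_three]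
    exact ⟨_, _, _, hab _ _, hac _ _ _, hbc _ _ _, rfl⟩
  have hrank : mrank M M.E = 3 := mrank_ground_eq hr hbase hcard
  refine ⟨M, kRepresentable_linearMatroid v hE, hrank, bwLE_of_mrank hr hrank ?_,
    hcross.not_dwLE hcross' hinj (by simp [n])⟩
  have := ncard_le_ncard hbase.subset_ground hE
  rw [hcard] at this
  exact le_trans (by omega) this

/-- for an infinite field K, the class of K-representable matroids is not
pigeonhole; indeed there are rank-3 K-representable matroids of arbitrarily high
decomposition-width. -/
theorem infinite_field_not_pigeonhole {α : Type*} [Infinite α]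
    (K : Type) [Field K] [Infinite K] :
    (∃ l : ℕ, 0 < l ∧ ∀ ρ : ℕ, ∃ M : Matroid α,
        KRepresentable K M ∧ bwLE M l ∧ ¬ dwLE M ρ) ∧
    (∀ k : ℕ, ∃ M : Matroid α, KRepresentable K M ∧ mrank M M.E = 3 ∧ ¬ dwLE M k) := by
  refine ⟨⟨4, by omega, fun ρ ↦ ?_⟩, fun k ↦ ?_⟩
  · obtain ⟨M, hK, -, hbw, hdw⟩ := exists_rank_three_not_dwLE (α := α) K ρ
    exact ⟨M, hK, hbw, hdw⟩
  · obtain ⟨M, hK, hr, -, hdw⟩ := exists_rank_three_not_dwLE (α := α) K k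
    exact ⟨M, hK, hr, hdw⟩
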